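/- arXiv:0801.2231 — 2 statements merged into one kernel-verified Lean document; each statement's English description precedes it below -/
import Mathlib

section
/- Let K > 0 and define M(θ₁, θ₂) = [ e^{θ₁}(1−e^{−θ₂K}) / ( θ₂ + e^{θ₁}(1−e^{−θ₂K}) ) ] · ( 1/θ₂ − K/(e^{θ₂K} − 1) ) for θ₁ ∈ ℝ and θ₂ > 0. Then for each fixed θ₂ > 0 the map θ₁ ↦ M(θ₁, θ₂) is strictly increasing on ℝ, and for each fixed θ₁ ∈ ℝ the map θ₂ ↦ M(θ₁, θ₂) is strictly decreasing on (0,∞). -/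
theorem strictAntiOn_one_sub_exp_neg_div :
    StrictAntiOn (fun x : ℝ => (1 - Real.exp (-x)) / x) (Set.Ioi 0) := by
  have hd (x : ℝ) (hx : 0 < x) : HasDerivAt (fun x : ℝ => (1 - Real.exp (-x)) / x)
      ((Real.exp (-x) * x - (1 - Real.exp (-x))) / x ^ 2) x := by
    refine (((hasDerivAt_neg x).exp.const_sub 1).div (hasDerivAt_id' x) hx.ne').congr_deriv ?_
    ring
  refine strictAntiOn_of_deriv_neg (convex_Ioi 0)
    (fun x hx => (hd x hx).continuousAt.continuousWithinAt) fun x hx => ?_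
  rw [interior_Ioi] at hx
  have hx : 0 < x := hx
  rw [(hd x hx).deriv]
  refine div_neg_of_neg_of_pos ?_ (by positivity)
  have h1 := Real.add_one_lt_exp hx.ne'
  have h2 : Real.exp (-x) * Real.exp x = 1 := by rw [← Real.exp_add]; simp
  nlinarith [mul_lt_mul_of_pos_left h1 (Real.exp_pos (-x))]

theorem sq_mul_exp_lt_exp_sub_one_sq {x : ℝ} (hx : 0 < x) :
    x ^ 2 * Real.exp x < (Real.exp x - 1) ^ 2 := by
  have h := Real.self_lt_sinh_iff.2 (half_pos hx)
  rw [Real.sinh_eq] at h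
  have h1 : Real.exp (-(x / 2)) * Real.exp (x / 2) = 1 := by rw [← Real.exp_add]; simp
  have h2 : Real.exp x = Real.exp (x / 2) ^ 2 := by
    rw [← Real.exp_nat_mul]
    congr 1
    push_cast
    ring
  have h3 : x * Real.exp (x / 2) < Real.exp x - 1 := by
    nlinarith [mul_lt_mul_of_pos_right h (Real.exp_pos (x / 2))]
  calc x ^ 2 * Real.exp x = (x * Real.exp (x / 2)) ^ 2 := by rw [h2]; ring
    _ < (Real.exp x - 1) ^ 2 := by gcongr

theorem strictAntiOn_inv_sub_inv_exp_sub_one :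
    StrictAntiOn (fun x : ℝ => x⁻¹ - (Real.exp x - 1)⁻¹) (Set.Ioi 0) := by
  have he {x : ℝ} (hx : 0 < x) : 0 < Real.exp x - 1 := by linarith [Real.add_one_lt_exp hx.ne']
  have hd (x : ℝ) (hx : 0 < x) : HasDerivAt (fun x : ℝ => x⁻¹ - (Real.exp x - 1)⁻¹)
      (-(x ^ 2)⁻¹ - -Real.exp x / (Real.exp x - 1) ^ 2) x :=
    (hasDerivAt_inv hx.ne').sub (((Real.hasDerivAt_exp x).sub_const 1).inv (he hx).ne')
  refine strictAntiOn_of_deriv_neg (convex_Ioi 0)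
    (fun x hx => (hd x hx).continuousAt.continuousWithinAt) fun x hx => ?_
  rw [interior_Ioi] at hx
  have hx : 0 < x := hx
  rw [(hd x hx).deriv]
  have h : Real.exp x / (Real.exp x - 1) ^ 2 < 1 / x ^ 2 := by
    rw [div_lt_div_iff₀ (pow_pos (he hx) 2) (by positivity)]
    linarith [sq_mul_exp_lt_exp_sub_one_sq hx]
  rw [one_div] at h
  rw [neg_div]
  linarith

theorem inv_sub_inv_exp_sub_one_pos {x : ℝ} (hx : 0 < x) : 0 < x⁻¹ - (Real.exp x - 1)⁻¹ :=
  sub_pos.2 (inv_strictAnti₀ hx (by linarith [Real.add_one_lt_exp hx.ne']))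

/-- The mean `M(θ₁,θ₂)` of the mixed truncated exponential distribution on
`{0} ∪ (0,K]`, expressed in natural parameters, is strictly increasing in `θ₁`
(for each fixed `θ₂ > 0`) and strictly decreasing in `θ₂` on `(0,∞)` (for each
fixed `θ₁`). -/
theorem mixed_truncated_exponential_mean_monotonicity
    (K : ℝ) (hK : 0 < K)
    (M : ℝ → ℝ → ℝ)
    (hM : ∀ θ₁ θ₂ : ℝ, M θ₁ θ₂
      = (Real.exp θ₁ * (1 - Real.exp (-θ₂ * K))
          / (θ₂ + Real.exp θ₁ * (1 - Real.exp (-θ₂ * K))))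
        * (1 / θ₂ - K / (Real.exp (θ₂ * K) - 1))) :
    (∀ θ₂ : ℝ, 0 < θ₂ → StrictMono (fun θ₁ => M θ₁ θ₂)) ∧
    (∀ θ₁ : ℝ, StrictAntiOn (fun θ₂ => M θ₁ θ₂) (Set.Ioi 0)) := by
  have hE (t : ℝ) (ht : 0 < t) : 1 / t - K / (Real.exp (t * K) - 1)
      = K * ((t * K)⁻¹ - (Real.exp (t * K) - 1)⁻¹) := by
    rw [mul_sub, ← div_eq_mul_inv, ← div_eq_mul_inv]
    congr 1
    field_simp
  have hEpos (t : ℝ) (ht : 0 < t) : 0 < 1 / t - K / (Real.exp (t * K) - 1) := by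
    rw [hE t ht]
    exact mul_pos hK (inv_sub_inv_exp_sub_one_pos (mul_pos ht hK))
  have hu (t : ℝ) (ht : 0 < t) : 0 < 1 - Real.exp (-t * K) := by
    rw [sub_pos, Real.exp_lt_one_iff, neg_mul]
    exact neg_neg_of_pos (mul_pos ht hK)
  refine ⟨fun t ht a b hab => ?_, fun a s hs t ht hst => ?_⟩
  · simp only [hM]
    have h := hu t ht
    have ha := mul_pos (Real.exp_pos a) h
    have hb := mul_pos (Real.exp_pos b) h
    refine mul_lt_mul_of_pos_right ?_ (hEpos t ht)
    rw [div_lt_div_iff₀ (by positivity) (by positivity)]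
    have := mul_lt_mul_of_pos_right (mul_lt_mul_of_pos_right (Real.exp_lt_exp.2 hab) h) ht
    linarith
  · have hs : 0 < s := hs
    have ht : 0 < t := ht
    have hsK := mul_pos hs hK
    have htK := mul_pos ht hK
    have hlt : s * K < t * K := mul_lt_mul_of_pos_right hst hK
    simp only [hM]
    have hus := mul_pos (Real.exp_pos a) (hu s hs)
    have hut := mul_pos (Real.exp_pos a) (hu t ht)
    refine mul_lt_mul'' ?_ ?_ (by positivity) (hEpos t ht).le
    · have h := strictAntiOn_one_sub_exp_neg_div hsK htK hlt
      simp only [← neg_mul] at h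
      rw [div_lt_div_iff₀ htK hsK, ← mul_assoc, ← mul_assoc] at h
      have h := mul_lt_mul_of_pos_left (lt_of_mul_lt_mul_right h hK.le) (Real.exp_pos a)
      rw [div_lt_div_iff₀ (by positivity) (by positivity)]
      linarith
    · rw [hE s hs, hE t ht]
      exact mul_lt_mul_of_pos_left (strictAntiOn_inv_sub_inv_exp_sub_one hsK htK hlt) hK
end

section
/- Let M, N ≥ 1 and let S = {1,…,M} × {1,…,N} be the two-dimensional lattice with the four-nearest-neighbours system: i = (i₁,i₂) and j = (j₁,j₂) are horizontal neighbours if i₁ = j₁ and |i₂ − j₂| = 1, and vertical neighbours if i₂ = j₂ and |i₁ − j₁| = 1. Let a, c₁, c₂ ∈ ℝ and b > 0, and define Q : [0,∞)^S → ℝ by Q(x) = Σ_{i∈S} ( a δ*(x_i) − b x_i² ) + c₁ Σ_{{i,j} horizontal pairs} δ*(x_i)δ*(x_j) + c₂ Σ_{{i,j} vertical pairs} δ*(x_i)δ*(x_j). Then ∫_{[0,∞)^S} exp(Q(x)) m^{⊗S}(dx) < ∞, where m = δ_0 + λ_Leb|_{(0,∞)} is the sum of the Dirac measure at 0 and Lebesgue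 measure on (0,∞). -/
open MeasureTheory

/-- `dstar x` is the indicator of nonzero values: `δ*(x) = 1` if `x ≠ 0`, `δ*(0) = 0`. -/
noncomputable def dstar (x : ℝ) : ℝ := if x = 0 then 0 else 1

lemma dstar_nonneg (x : ℝ) : 0 ≤ dstar x := by
  unfold dstar; split_ifs <;> norm_num

lemma dstar_le_one (x : ℝ) : dstar x ≤ 1 := by
  unfold dstar; split_ifs <;> norm_num

lemma exists_mul_sum_dstar_mul_dstar_le {ι : Type*} (s : Finset (ι × ι)) (c : ℝ) :
    ∃ C : ℝ, ∀ x : ι → ℝ, c * ∑ p ∈ s, dstar (x p.1) * dstar (x p.2) ≤ C := by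
  refine ⟨|c| * s.card, fun x => ?_⟩
  have h0 : 0 ≤ ∑ p ∈ s, dstar (x p.1) * dstar (x p.2) :=
    Finset.sum_nonneg fun p _ => mul_nonneg (dstar_nonneg _) (dstar_nonneg _)
  have h1 : ∑ p ∈ s, dstar (x p.1) * dstar (x p.2) ≤ s.card := by
    simpa using Finset.sum_le_card_nsmul s _ 1 fun p _ =>
      mul_le_one₀ (dstar_le_one (x p.1)) (dstar_nonneg (x p.2)) (dstar_le_one (x p.2))
  exact (mul_le_mul_of_nonneg_right (le_abs_self c) h0).trans
    (mul_le_mul_of_nonneg_left h1 (abs_nonneg c))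

lemma integrable_exp_neg_mul_sq_dirac_add_restrict {b : ℝ} (hb : 0 < b) (s : Set ℝ) :
    Integrable (fun x : ℝ => Real.exp (-b * x ^ 2))
      (Measure.dirac 0 + volume.restrict s) :=
  (integrable_dirac (by simp)).add_measure (integrable_exp_neg_mul_sq hb).restrict

/-- A function on a finite product is exponentially integrable as soon as it is bounded above by a
constant minus a positive multiple of the sum of squares. -/
lemma lintegral_exp_lt_top_of_le {ι : Type*} [Fintype ι] {b C : ℝ} (hb : 0 < b)
    (s : Set ℝ) {Q : (ι → ℝ) → ℝ} (hQ : ∀ x, Q x ≤ C + ∑ i, -b * x i ^ 2) :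
    ∫⁻ x : ι → ℝ, ENNReal.ofReal (Real.exp (Q x))
      ∂(Measure.pi fun _ : ι => (Measure.dirac 0 + volume.restrict s)) < ⊤ := by
  have hint : Integrable (fun x : ι → ℝ => Real.exp C * ∏ i, Real.exp (-b * x i ^ 2))
      (Measure.pi fun _ : ι => (Measure.dirac 0 + volume.restrict s)) :=
    (Integrable.fintype_prod fun _ : ι =>
      integrable_exp_neg_mul_sq_dirac_add_restrict hb s).const_mul _
  refine lt_of_le_of_lt (lintegral_mono fun x => ENNReal.ofReal_le_ofReal ?_)
    hint.lintegral_lt_top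
  rw [← Real.exp_sum, ← Real.exp_add]
  exact Real.exp_le_exp.2 (hQ x)

/-- Admissibility of the translation-invariant, spatially symmetric,
cooperative mixed-state auto-model with positive Gaussian conditional
distributions on the `M × N` lattice with the four-nearest-neighbours system:
for any `a, c₁, c₂ ∈ ℝ` and `b > 0`, the Gibbs density `exp ∘ Q` is integrable
with respect to the product of the reference measures `m = δ₀ + Leb|(0,∞)`.
Each unordered horizontal (resp. vertical) neighbour pair `{i,j}` is counted
once, as the ordered pair whose second coordinate (resp. first coordinate)
increases by one. -/
theorem mixed_positive_gaussian_automodel_integrable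
    (M N : ℕ) (hM : 1 ≤ M) (hN : 1 ≤ N)
    (a c₁ c₂ b : ℝ) (hb : 0 < b)
    (Q : (Fin M × Fin N → ℝ) → ℝ)
    (hQ : ∀ x : Fin M × Fin N → ℝ,
      Q x = ∑ i : Fin M × Fin N, (a * dstar (x i) - b * (x i) ^ 2)
        + c₁ * ∑ p ∈ Finset.univ.filter
            (fun p : (Fin M × Fin N) × (Fin M × Fin N) =>
              p.1.1 = p.2.1 ∧ (p.1.2 : ℕ) + 1 = (p.2.2 : ℕ)),
            dstar (x p.1) * dstar (x p.2)
        + c₂ * ∑ p ∈ Finset.univ.filter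
            (fun p : (Fin M × Fin N) × (Fin M × Fin N) =>
              p.1.2 = p.2.2 ∧ (p.1.1 : ℕ) + 1 = (p.2.1 : ℕ)),
            dstar (x p.1) * dstar (x p.2)) :
    ∫⁻ x : Fin M × Fin N → ℝ, ENNReal.ofReal (Real.exp (Q x))
      ∂(Measure.pi fun _ : Fin M × Fin N =>
          (Measure.dirac 0 + volume.restrict (Set.Ioi 0))) < ⊤ := by
  have hsite : ∀ x : Fin M × Fin N → ℝ,
      ∑ i, (a * dstar (x i) - b * x i ^ 2) ≤
        ∑ _i : Fin M × Fin N, |a| + ∑ i, -b * x i ^ 2 := by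
    intro x
    rw [← Finset.sum_add_distrib]
    refine Finset.sum_le_sum fun i _ => ?_
    have h := (mul_le_mul_of_nonneg_right (le_abs_self a) (dstar_nonneg (x i))).trans
      (mul_le_of_le_one_right (abs_nonneg a) (dstar_le_one (x i)))
    linarith
  obtain ⟨C₁, h₁⟩ := exists_mul_sum_dstar_mul_dstar_le (Finset.univ.filter
    (fun p : (Fin M × Fin N) × (Fin M × Fin N) =>
      p.1.1 = p.2.1 ∧ (p.1.2 : ℕ) + 1 = (p.2.2 : ℕ))) c₁
  obtain ⟨C₂, h₂⟩ := exists_mul_sum_dstar_mul_dstar_le (Finset.univ.filter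
    (fun p : (Fin M × Fin N) × (Fin M × Fin N) =>
      p.1.2 = p.2.2 ∧ (p.1.1 : ℕ) + 1 = (p.2.1 : ℕ))) c₂
  refine lintegral_exp_lt_top_of_le (C := ∑ _i : Fin M × Fin N, |a| + C₁ + C₂) hb _ fun x => ?_
  rw [hQ x]
  linarith [hsite x, h₁ x, h₂ x]
end
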